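/- arXiv:2002.01569 — 3 statements merged into one kernel-verified Lean document; each statement's English description precedes it below -/
import Mathlib

section
/- There exists a universal constant η₂ (independent of p, Ω, Ψ, σ, n, and the design) such that for every u > 0, P( sup_{x∈Ω} (Z(x) − μ(x)) / (σ(x) log^{1/2}(eσ/σ(x))) > η₂ √(p (1 ∨ log(A₀ D_Ω))) + u ) ≤ exp(−u²/(4e²)) / (1 − exp(−u²/(4e²))), with the convention 0/0 = 0. -/
open MeasureTheory ProbabilityTheory
open scoped RealInnerProductSpace

noncomputable def kmat {p n : ℕ} (Ψ : EuclideanSpace ℝ (Fin p) → ℝ)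
    (xs : Fin n → EuclideanSpace ℝ (Fin p)) : Matrix (Fin n) (Fin n) ℝ :=
  Matrix.of fun j k => Ψ (xs j - xs k)

noncomputable def kinterp {p n : ℕ} (Ψ : EuclideanSpace ℝ (Fin p) → ℝ)
    (xs : Fin n → EuclideanSpace ℝ (Fin p)) (f : EuclideanSpace ℝ (Fin p) → ℝ)
    (v : EuclideanSpace ℝ (Fin p)) : ℝ :=
  ∑ j, ∑ k, Ψ (v - xs j) * (kmat Ψ xs)⁻¹ j k * f (xs k)

noncomputable def krigSd {p n : ℕ} (Ψ : EuclideanSpace ℝ (Fin p) → ℝ)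
    (xs : Fin n → EuclideanSpace ℝ (Fin p)) (σ : ℝ)
    (v : EuclideanSpace ℝ (Fin p)) : ℝ :=
  σ * Real.sqrt (1 - ∑ j, ∑ k, Ψ (v - xs j) * (kmat Ψ xs)⁻¹ j k * Ψ (v - xs k))

noncomputable def krigRatio {p n : ℕ} (Ψ : EuclideanSpace ℝ (Fin p) → ℝ)
    (xs : Fin n → EuclideanSpace ℝ (Fin p)) (σ : ℝ)
    (f : EuclideanSpace ℝ (Fin p) → ℝ) (v : EuclideanSpace ℝ (Fin p)) : ℝ :=
  (f v - kinterp Ψ xs f v) /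
    (krigSd Ψ xs σ v * Real.sqrt (Real.log (Real.exp 1 * σ / krigSd Ψ xs σ v)))

def GaussCov {p : ℕ} {Ω' : Type*} [MeasurableSpace Ω'] (P : Measure Ω')
    (Z : EuclideanSpace ℝ (Fin p) → Ω' → ℝ) (σ : ℝ)
    (Ψ : EuclideanSpace ℝ (Fin p) → ℝ) : Prop :=
  ∀ (m : ℕ) (c : Fin m → ℝ) (y : Fin m → EuclideanSpace ℝ (Fin p)),
    Measure.map (fun ω' => ∑ i, c i * Z (y i) ω') P =
      gaussianReal 0 (∑ i, ∑ j, c i * c j * (σ ^ 2 * Ψ (y i - y j))).toNNReal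

def IsSpectralDensity {p : ℕ} (Ψ Ψt : EuclideanSpace ℝ (Fin p) → ℝ) : Prop :=
  (∀ ω, 0 ≤ Ψt ω) ∧ Integrable Ψt ∧ ((∫ ω, Ψt ω) = 1) ∧
    ∀ v, Ψ v = ∫ ω, Real.cos ⟪ω, v⟫ * Ψt ω

noncomputable def A0 {p : ℕ} (Ψt : EuclideanSpace ℝ (Fin p) → ℝ) : ℝ :=
  ∫ ω, (∑ i, |ω i|) * Ψt ω

lemma aux_gtail {Ω' : Type*} [MeasurableSpace Ω'] (P : Measure Ω') [IsProbabilityMeasure P]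
    (X : Ω' → ℝ) (hX : Measurable X) (v : NNReal) (hl : Measure.map X P = gaussianReal 0 v)
    (V t : ℝ) (hV : 0 ≤ V) (hv : (v : ℝ) ≤ V) (ht : 0 ≤ t) :
    P {ω | Real.sqrt V * t < X ω} ≤ ENNReal.ofReal (Real.exp (-t ^ 2 / 2)) := by
  rcases hV.eq_or_lt with h0 | hpos
  · have hv0 : v = 0 := by
      apply le_antisymm _ bot_le
      rw [← NNReal.coe_le_coe]; simpa [← h0] using hv
    have : P {ω | Real.sqrt V * t < X ω} = (Measure.map X P) (Set.Ioi 0) := by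
      rw [Measure.map_apply hX measurableSet_Ioi]
      congr 1; ext ω; simp [← h0]
    rw [this, hl, hv0, gaussianReal_zero_var]
    simp
  · have hs : HasSubgaussianMGF X V.toNNReal P := by
      refine ⟨fun t => ?_, fun t => ?_⟩
      · have := integrable_exp_mul_gaussianReal (μ := 0) (v := v) t
        rw [← hl] at this
        exact this.comp_measurable hX
      · rw [mgf_gaussianReal hl]
        apply Real.exp_le_exp.2
        rw [Real.coe_toNNReal _ hV]
        nlinarith [sq_nonneg t]
    have h1 := hs.measure_ge_le (ε := Real.sqrt V * t) (by positivity)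
    rw [Real.coe_toNNReal _ hV, mul_pow, Real.sq_sqrt hV] at h1
    have h2 : -(V * t ^ 2) / (2 * V) = -t ^ 2 / 2 := by field_simp
    rw [h2] at h1
    calc P {ω | Real.sqrt V * t < X ω} ≤ P {ω | Real.sqrt V * t ≤ X ω} :=
          measure_mono fun ω h => by
            simp only [Set.mem_ofPred_eq] at h ⊢; exact h.le
      _ = ENNReal.ofReal (P.real {ω | Real.sqrt V * t ≤ X ω}) := by simp
      _ ≤ _ := ENNReal.ofReal_le_ofReal h1

section psi
variable {p : ℕ} {Ψ Ψt : EuclideanSpace ℝ (Fin p) → ℝ}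

lemma aux_int_cos (h : IsSpectralDensity Ψ Ψt) (v : EuclideanSpace ℝ (Fin p)) :
    Integrable (fun ω => Real.cos ⟪ω, v⟫ * Ψt ω) := by
  refine h.2.1.bdd_mul (c := 1) (Continuous.aestronglyMeasurable (by fun_prop)) ?_
  exact Filter.Eventually.of_forall fun ω => by simpa using Real.abs_cos_le_one _

lemma aux_psi_zero (h : IsSpectralDensity Ψ Ψt) : Ψ 0 = 1 := by
  rw [h.2.2.2]; simpa using h.2.2.1

lemma aux_psi_neg (h : IsSpectralDensity Ψ Ψt) (v : EuclideanSpace ℝ (Fin p)) : Ψ (-v) = Ψ v := by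
  rw [h.2.2.2, h.2.2.2]; simp

lemma aux_psi_cont (h : IsSpectralDensity Ψ Ψt) : Continuous Ψ := by
  have : Ψ = fun v => ∫ ω, Real.cos ⟪ω, v⟫ * Ψt ω := funext h.2.2.2
  rw [this]
  apply continuous_of_dominated (bound := fun ω => Ψt ω)
  · exact fun v => (aux_int_cos h v).aestronglyMeasurable
  · intro v
    refine Filter.Eventually.of_forall fun ω => ?_
    rw [norm_mul, Real.norm_of_nonneg (h.1 ω)]
    exact mul_le_of_le_one_left (h.1 ω) (by simpa using Real.abs_cos_le_one _)
  · exact h.2.1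
  · exact Filter.Eventually.of_forall fun ω => by fun_prop

lemma aux_quad_nonneg (h : IsSpectralDensity Ψ Ψt) {ι : Type*} [Fintype ι] (c : ι → ℝ)
    (y : ι → EuclideanSpace ℝ (Fin p)) : 0 ≤ ∑ i, ∑ j, c i * c j * Ψ (y i - y j) := by
  have : ∑ i, ∑ j, c i * c j * Ψ (y i - y j) =
      ∫ ω, ∑ i, ∑ j, c i * c j * (Real.cos ⟪ω, y i - y j⟫ * Ψt ω) := by
    rw [integral_finsetSum]
    · refine Finset.sum_congr rfl fun i _ => ?_
      rw [integral_finsetSum]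
      · refine Finset.sum_congr rfl fun j _ => ?_
        rw [integral_const_mul, h.2.2.2]
      · exact fun j _ => (aux_int_cos h _).const_mul _
    · exact fun i _ => integrable_finsetSum _ fun j _ => (aux_int_cos h _).const_mul _
  rw [this]
  apply integral_nonneg
  intro ω
  have h2 : ∑ i, ∑ j, c i * c j * (Real.cos ⟪ω, y i - y j⟫ * Ψt ω) =
      ((∑ i, c i * Real.cos ⟪ω, y i⟫) ^ 2 + (∑ i, c i * Real.sin ⟪ω, y i⟫) ^ 2) * Ψt ω := by
    rw [sq, sq, Finset.sum_mul_sum, Finset.sum_mul_sum, ← Finset.sum_add_distrib, Finset.sum_mul]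
    refine Finset.sum_congr rfl fun i _ => ?_
    rw [← Finset.sum_add_distrib, Finset.sum_mul]
    refine Finset.sum_congr rfl fun j _ => ?_
    rw [inner_sub_right, Real.cos_sub]; ring
  simp only [Pi.zero_apply]
  rw [h2]
  exact mul_nonneg (by positivity) (h.1 ω)

lemma aux_one_sub_cos (t : ℝ) : 1 - Real.cos t ≤ |t| := by
  rcases le_total |t| 2 with h | h
  · have := Real.one_sub_sq_div_two_le_cos (x := t)
    have h3 : t ^ 2 = |t| ^ 2 := (sq_abs t).symm
    nlinarith [abs_nonneg t]
  · linarith [Real.neg_one_le_cos t]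

lemma aux_one_sub_psi (h : IsSpectralDensity Ψ Ψt)
    (hA : Integrable (fun ω => (∑ i, |ω i|) * Ψt ω)) (v : EuclideanSpace ℝ (Fin p)) (δ : ℝ)
    (hδ : ∀ i, |v i| ≤ δ) : 1 - Ψ v ≤ A0 Ψt * δ := by
  rw [h.2.2.2, ← h.2.2.1, ← integral_sub h.2.1 (aux_int_cos h v), A0, ← integral_mul_const]
  apply integral_mono (h.2.1.sub (aux_int_cos h v)) (hA.mul_const δ)
  intro ω
  have h1 := aux_one_sub_cos ⟪ω, v⟫
  have h2 : |⟪ω, v⟫| ≤ (∑ i, |ω i|) * δ := by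
    rw [PiLp.inner_apply, Finset.sum_mul]
    refine (Finset.abs_sum_le_sum_abs _ _).trans (Finset.sum_le_sum fun i _ => ?_)
    simp only [RCLike.inner_apply, conj_trivial, abs_mul]
    rw [mul_comm]
    exact mul_le_mul_of_nonneg_left (hδ i) (abs_nonneg _)
  have h3 := mul_le_mul_of_nonneg_right (h1.trans h2) (h.1 ω)
  simp only [Pi.sub_apply]
  nlinarith

lemma aux_A0_nonneg (h : IsSpectralDensity Ψ Ψt) : 0 ≤ A0 Ψt :=
  integral_nonneg fun ω => mul_nonneg (Finset.sum_nonneg fun _ _ => abs_nonneg _) (h.1 ω)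

lemma aux_gauss_fintype {Ω' : Type*} [MeasurableSpace Ω'] {P : Measure Ω'}
    {Z : EuclideanSpace ℝ (Fin p) → Ω' → ℝ} {σ : ℝ} (hG : GaussCov P Z σ Ψ)
    {ι : Type*} [Fintype ι] (c : ι → ℝ) (y : ι → EuclideanSpace ℝ (Fin p)) :
    Measure.map (fun ω' => ∑ i, c i * Z (y i) ω') P =
      gaussianReal 0 (σ ^ 2 * ∑ i, ∑ j, c i * c j * Ψ (y i - y j)).toNNReal := by
  have e := (Fintype.equivFin ι).symm
  have h := hG (Fintype.card ι) (c ∘ e) (y ∘ e)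
  have h1 : (fun ω' => ∑ i, (c ∘ e) i * Z ((y ∘ e) i) ω') = fun ω' => ∑ i, c i * Z (y i) ω' := by
    funext ω'
    exact e.sum_comp (fun i => c i * Z (y i) ω')
  have h2 : ∑ i, ∑ j, (c ∘ e) i * (c ∘ e) j * (σ ^ 2 * Ψ ((y ∘ e) i - (y ∘ e) j)) =
      σ ^ 2 * ∑ i, ∑ j, c i * c j * Ψ (y i - y j) := by
    rw [← e.sum_comp, Finset.mul_sum]
    refine Finset.sum_congr rfl fun i _ => ?_
    rw [← e.sum_comp, Finset.mul_sum]
    refine Finset.sum_congr rfl fun j _ => ?_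
    simp only [Function.comp]; ring
  rw [h1, h2] at h
  exact h

/-- Posterior covariance kernel. -/
noncomputable def auxR {n : ℕ} (Ψ : EuclideanSpace ℝ (Fin p) → ℝ)
    (xs : Fin n → EuclideanSpace ℝ (Fin p)) (x y : EuclideanSpace ℝ (Fin p)) : ℝ :=
  Ψ (x - y) - ∑ j, ∑ k, Ψ (x - xs j) * (kmat Ψ xs)⁻¹ j k * Ψ (y - xs k)

noncomputable def auxV {n : ℕ} (Ψ : EuclideanSpace ℝ (Fin p) → ℝ)
    (xs : Fin n → EuclideanSpace ℝ (Fin p)) (x y : EuclideanSpace ℝ (Fin p)) (a b : ℝ) : ℝ :=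
  a ^ 2 * auxR Ψ xs x x + a * b * (auxR Ψ xs x y + auxR Ψ xs y x) + b ^ 2 * auxR Ψ xs y y

open Matrix in
lemma aux_form (h : IsSpectralDensity Ψ Ψt) {n : ℕ} (xs : Fin n → EuclideanSpace ℝ (Fin p))
    (hdet : IsUnit (kmat Ψ xs).det) (x y : EuclideanSpace ℝ (Fin p)) (a b : ℝ) :
    ∃ (c : Fin 2 ⊕ Fin n → ℝ) (z : Fin 2 ⊕ Fin n → EuclideanSpace ℝ (Fin p)),
      (∀ f : EuclideanSpace ℝ (Fin p) → ℝ, ∑ i, c i * f (z i) =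
        a * (f x - kinterp Ψ xs f x) + b * (f y - kinterp Ψ xs f y)) ∧
      ∑ i, ∑ j, c i * c j * Ψ (z i - z j) = auxV Ψ xs x y a b ∧
      auxV Ψ xs x y a b ≤ a ^ 2 + 2 * a * b * Ψ (x - y) + b ^ 2 := by
  set K := kmat Ψ xs with hK
  set r : Fin n → ℝ := fun j => a * Ψ (x - xs j) + b * Ψ (y - xs j) with hr
  set d : Fin n → ℝ := r ᵥ* K⁻¹ with hd
  have hsym : ∀ u v, Ψ (u - v) = Ψ (v - u) := fun u v => by
    rw [← aux_psi_neg h]; simp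
  have hdK : d ᵥ* K = r := by
    rw [hd, Matrix.vecMul_vecMul, Matrix.nonsing_inv_mul _ hdet, Matrix.vecMul_one]
  -- quadratic form of d
  have hq : ∑ j, ∑ k, d j * d k * Ψ (xs j - xs k) = d ⬝ᵥ r := by
    conv_rhs => rw [← hdK]
    simp only [dotProduct, vecMul]
    refine Finset.sum_congr rfl fun j _ => ?_
    rw [Finset.mul_sum]
    refine Finset.sum_congr rfl fun k _ => ?_
    simp only [hK, kmat, Matrix.of_apply]
    rw [hsym (xs j)]; ring
  have hV : auxV Ψ xs x y a b = a ^ 2 + 2 * a * b * Ψ (x - y) + b ^ 2 - d ⬝ᵥ r := by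
    have e1 : d ⬝ᵥ r = ∑ j, ∑ k, r j * K⁻¹ j k * r k := by
      simp only [dotProduct, hd, vecMul, Finset.sum_mul]
      rw [Finset.sum_comm]
    have e2 : d ⬝ᵥ r = a ^ 2 * (∑ j, ∑ k, Ψ (x - xs j) * K⁻¹ j k * Ψ (x - xs k)) +
        a * b * ((∑ j, ∑ k, Ψ (x - xs j) * K⁻¹ j k * Ψ (y - xs k)) +
          ∑ j, ∑ k, Ψ (y - xs j) * K⁻¹ j k * Ψ (x - xs k)) +
        b ^ 2 * (∑ j, ∑ k, Ψ (y - xs j) * K⁻¹ j k * Ψ (y - xs k)) := by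
      rw [e1]
      simp only [Finset.mul_sum, ← Finset.sum_add_distrib]
      refine Finset.sum_congr rfl fun j _ => Finset.sum_congr rfl fun k _ => ?_
      simp only [hr]; ring
    rw [e2, auxV, auxR, auxR, auxR, auxR, hsym y x]
    simp only [sub_self, aux_psi_zero h]
    ring
  refine ⟨Sum.elim ![a, b] (fun k => -d k), Sum.elim ![x, y] xs, ?_, ?_, ?_⟩
  · intro f
    have e : ∑ k, d k * f (xs k) = a * kinterp Ψ xs f x + b * kinterp Ψ xs f y := by
      simp only [hd, vecMul, dotProduct, kinterp, Finset.sum_mul, Finset.mul_sum,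
        ← Finset.sum_add_distrib]
      rw [Finset.sum_comm]
      refine Finset.sum_congr rfl fun j _ => Finset.sum_congr rfl fun k _ => ?_
      simp only [hr]; ring
    simp only [Fintype.sum_sum_type, Fin.sum_univ_two, Sum.elim_inl, Sum.elim_inr, neg_mul,
      Finset.sum_neg_distrib, e, cons_val_zero, cons_val_one]
    ring
  · rw [hV]
    have e1 : ∑ k, d k * Ψ (x - xs k) * a + ∑ k, d k * Ψ (y - xs k) * b = d ⬝ᵥ r := by
      simp only [dotProduct, hr, ← Finset.sum_add_distrib]
      refine Finset.sum_congr rfl fun k _ => by ring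
    have e2 : ∑ k, (-d k * a * Ψ (xs k - x) + -d k * b * Ψ (xs k - y)) = -(d ⬝ᵥ r) := by
      rw [← e1, ← Finset.sum_add_distrib, ← Finset.sum_neg_distrib]
      refine Finset.sum_congr rfl fun k _ => ?_
      rw [hsym (xs k), hsym (xs k)]; ring
    have e3 : ∑ k, a * -d k * Ψ (x - xs k) + ∑ k, b * -d k * Ψ (y - xs k) = -(d ⬝ᵥ r) := by
      rw [← e1, ← Finset.sum_add_distrib, ← Finset.sum_add_distrib, ← Finset.sum_neg_distrib]
      refine Finset.sum_congr rfl fun k _ => by ring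
    have e4 : ∑ j, ∑ k, -d j * -d k * Ψ (xs j - xs k) = d ⬝ᵥ r := by
      rw [← hq]; simp only [neg_mul_neg]
    simp only [Fintype.sum_sum_type, Fin.sum_univ_two, Sum.elim_inl, Sum.elim_inr,
      cons_val_zero, cons_val_one, Finset.sum_add_distrib, sub_self, aux_psi_zero h, hsym y x, e4]
    rw [Finset.sum_add_distrib] at e2
    linarith
  · rw [hV]
    have := aux_quad_nonneg h d xs
    linarith

end psi
lemma aux_grid {p : ℕ} {Ω : Set (EuclideanSpace ℝ (Fin p))} (hne : Ω.Nonempty) {D : ℝ}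
    (hD : 0 < D) (hΩ : ∀ x ∈ Ω, ∀ y ∈ Ω, ∀ i, |x i - y i| ≤ D) (M : ℕ) (hM : 0 < M) :
    ∃ π : EuclideanSpace ℝ (Fin p) → EuclideanSpace ℝ (Fin p),
      (∀ x ∈ Ω, π x ∈ Ω) ∧ (∀ x ∈ Ω, ∀ i, |x i - π x i| ≤ D / M) ∧
      ∃ T : Finset (EuclideanSpace ℝ (Fin p)), (∀ x ∈ Ω, π x ∈ T) ∧ T.card ≤ (3 * M) ^ p := by
  classical
  obtain ⟨x0, hx0⟩ := hne
  have hM' : (0 : ℝ) < M := by exact_mod_cast hM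
  let c : EuclideanSpace ℝ (Fin p) → (Fin p → ℤ) := fun x i => ⌊(x i - x0 i) * M / D⌋
  let g : (Fin p → ℤ) → EuclideanSpace ℝ (Fin p) := fun k =>
    if h : ∃ y, y ∈ Ω ∧ c y = k then h.choose else x0
  have hg : ∀ x ∈ Ω, g (c x) ∈ Ω ∧ c (g (c x)) = c x := by
    intro x hx
    have h : ∃ y, y ∈ Ω ∧ c y = c x := ⟨x, hx, rfl⟩
    have e : g (c x) = h.choose := by simp only [g]; rw [dif_pos h]
    rw [e]; exact h.choose_spec
  refine ⟨fun x => g (c x), fun x hx => (hg x hx).1, ?_,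
    (Fintype.piFinset fun _ : Fin p => Finset.Icc (-(M : ℤ)) M).image g, ?_, ?_⟩
  · intro x hx i
    have h1 : ⌊(g (c x) i - x0 i) * M / D⌋ = ⌊(x i - x0 i) * M / D⌋ := congrFun (hg x hx).2 i
    have h2 := Int.abs_sub_lt_one_of_floor_eq_floor h1.symm
    have h3 : (x i - x0 i) * M / D - (g (c x) i - x0 i) * M / D =
        (x i - g (c x) i) * (M / D) := by ring
    rw [h3, abs_mul, abs_of_pos (by positivity : (0:ℝ) < M / D)] at h2
    have h4 : |x i - g (c x) i| = |x i - g (c x) i| * (M / D) * (D / M) := by field_simp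
    rw [h4]
    calc _ ≤ 1 * (D / M) := by gcongr
      _ = _ := one_mul _
  · intro x hx
    refine Finset.mem_image_of_mem _ ?_
    rw [Fintype.mem_piFinset]
    intro i
    have := abs_le.1 (hΩ x hx x0 hx0 i)
    rw [Finset.mem_Icc]
    constructor
    · rw [Int.le_floor, le_div_iff₀ hD]; push_cast; nlinarith
    · have : ((⌊(x i - x0 i) * M / D⌋ : ℤ) : ℝ) ≤ M := by
        refine (Int.floor_le _).trans ?_
        rw [div_le_iff₀ hD]; nlinarith
      exact_mod_cast this
  · refine Finset.card_image_le.trans ?_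
    rw [Fintype.card_piFinset]
    simp only [Int.card_Icc, Finset.prod_const, Finset.card_univ, Fintype.card_fin]
    apply Nat.pow_le_pow_left
    omega

lemma aux_chain (w : ℕ → ℝ) (wx sx β : ℝ) (sπ : ℕ → ℝ) (hβ : 0 ≤ β) (hsx : 0 < sx) (hsx1 : sx ≤ 1)
    (hlim : Filter.Tendsto w Filter.atTop (nhds wx))
    (h1 : ∀ j : ℕ, w j ≤ sπ j * (Real.sqrt (1 + j) * β))
    (h2 : ∀ j : ℕ, w (j + 1) - w j ≤ (1 / 4 : ℝ) ^ (j + 1) * (Real.sqrt (1 + j) * β))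
    (h3 : ∀ j : ℕ, sπ j ^ 2 ≤ 2 * sx ^ 2 + ((1 / 4 : ℝ) ^ (j + 1)) ^ 2) :
    wx / (sx * Real.sqrt (Real.log (Real.exp 1 / sx))) ≤ 15 / 4 * β := by
  obtain ⟨k, hk1, hk2⟩ := exists_nat_pow_near_of_lt_one hsx hsx1 (y := (1 / 4 : ℝ))
    (by norm_num) (by norm_num)
  have hind : ∀ m : ℕ, w (k + m) ≤ w k +
      (1 / 4 : ℝ) ^ (k + 1) * (Real.sqrt (1 + k) * β) * (2 - 2 * (1 / 2) ^ m) := by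
    intro m
    induction m with
    | zero => simp
    | succ m ih =>
      have a1 := h2 (k + m)
      have a2 : Real.sqrt (1 + (k + m : ℕ)) ≤ Real.sqrt (1 + k) * 2 ^ m := by
        have : Real.sqrt (1 + k) * 2 ^ m = Real.sqrt ((1 + k) * (2 ^ m) ^ 2) := by
          rw [Real.sqrt_mul (by positivity), Real.sqrt_sq (by positivity)]
        rw [this]
        apply Real.sqrt_le_sqrt
        have b1 : (1 + m : ℝ) ≤ 2 ^ m := by
          have := one_add_mul_le_pow (a := (1 : ℝ)) (by norm_num) m
          norm_num at this; linarith
        have b2 : (2 : ℝ) ^ m ≤ (2 ^ m) ^ 2 := by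
          have : (1 : ℝ) ≤ 2 ^ m := one_le_pow₀ (by norm_num)
          nlinarith
        push_cast
        have : (0 : ℝ) ≤ k := by positivity
        have : (0 : ℝ) ≤ m := by positivity
        nlinarith
      have a3 : (1 / 4 : ℝ) ^ (k + m + 1) * (Real.sqrt (1 + (k + m : ℕ)) * β) ≤
          (1 / 4 : ℝ) ^ (k + 1) * (Real.sqrt (1 + k) * β) * (1 / 2) ^ m := by
        calc _ ≤ (1 / 4 : ℝ) ^ (k + m + 1) * (Real.sqrt (1 + k) * 2 ^ m * β) := by gcongr
          _ = (1 / 4 : ℝ) ^ (k + 1) * (Real.sqrt (1 + k) * β) * ((1 / 4) ^ m * 2 ^ m) := by ring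
          _ = _ := by rw [← mul_pow]; norm_num
      rw [← add_assoc, pow_succ (1 / 2 : ℝ) m]
      linarith
  have hwx : wx ≤ w k + (1 / 4 : ℝ) ^ (k + 1) * (Real.sqrt (1 + k) * β) * 2 := by
    have hl := (Filter.tendsto_add_atTop_iff_nat k).2 hlim
    refine le_of_tendsto' hl fun m => ?_
    rw [add_comm m k]
    refine (hind m).trans ?_
    gcongr
    have : (0 : ℝ) ≤ (1 / 2) ^ m := by positivity
    linarith
  have hsk : sπ k ≤ 7 / 4 * sx := by
    have := h3 k
    have : ((1 / 4 : ℝ) ^ (k + 1)) ^ 2 ≤ sx ^ 2 := by gcongr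
    refine (le_abs_self _).trans (abs_le_of_sq_le_sq ?_ (by positivity))
    nlinarith
  have hlog : 1 + (k : ℝ) ≤ Real.log (Real.exp 1 / sx) := by
    rw [Real.log_div (by positivity) hsx.ne', Real.log_exp]
    have b : Real.log sx ≤ Real.log ((1 / 4 : ℝ) ^ k) := Real.log_le_log hsx hk2
    rw [Real.log_pow] at b
    have c : Real.log (1 / 4 : ℝ) ≤ -1 := by
      rw [Real.log_le_iff_le_exp (by norm_num), Real.exp_neg, one_div]
      apply inv_anti₀ (Real.exp_pos 1)
      linarith [Real.exp_one_lt_d9]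
    have : (0 : ℝ) ≤ k := by positivity
    nlinarith
  have hsq : Real.sqrt (1 + k) ≤ Real.sqrt (Real.log (Real.exp 1 / sx)) := Real.sqrt_le_sqrt hlog
  have hq0 : 0 < Real.sqrt (1 + (k : ℝ)) := Real.sqrt_pos.2 (by positivity)
  rw [div_le_iff₀ (mul_pos hsx (hq0.trans_le hsq))]
  calc wx ≤ sπ k * (Real.sqrt (1 + k) * β) + (1 / 4 : ℝ) ^ (k + 1) * (Real.sqrt (1 + k) * β) * 2 := by
        linarith [h1 k]
    _ ≤ (7 / 4 * sx) * (Real.sqrt (1 + k) * β) + sx * (Real.sqrt (1 + k) * β) * 2 := by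
        gcongr
    _ = 15 / 4 * β * (sx * Real.sqrt (1 + k)) := by ring
    _ ≤ _ := by gcongr

lemma aux_num (p : ℕ) (hp : 0 < p) (L m u : ℝ) (hL : 1 ≤ L) (hm0 : 0 ≤ m) (hm : m ≤ 2 * Real.exp L)
    (hu : 0 < u) (j : ℕ) :
    ((3 * (64 * m * 16 ^ j)) ^ p + (3 * (64 * m * 16 ^ j)) ^ p * (3 * (64 * m * 16 ^ (j + 1))) ^ p)
      * Real.exp (-(Real.sqrt (1 + j) * (8 * Real.sqrt (p * L) + 4 / 15 * u)) ^ 2 / 2) ≤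
    (1 / 2) ^ (j + 1) * Real.exp (-u ^ 2 / (4 * Real.exp 1 ^ 2)) := by
  have he : (2.7182818283 : ℝ) < Real.exp 1 := Real.exp_one_gt_d9
  have hj : (0 : ℝ) ≤ j := by positivity
  have hp1 : (1 : ℝ) ≤ p := by exact_mod_cast hp
  have e6 : (384 : ℝ) ≤ Real.exp 6 := by
    have : Real.exp 6 = Real.exp 1 ^ 6 := by rw [← Real.exp_nat_mul]; norm_num
    rw [this]
    calc (384 : ℝ) ≤ 2.7182818283 ^ 6 := by norm_num
      _ ≤ _ := by gcongr
  have e3 : (16 : ℝ) ≤ Real.exp 3 := by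
    have : Real.exp 3 = Real.exp 1 ^ 3 := by rw [← Real.exp_nat_mul]; norm_num
    rw [this]
    calc (16 : ℝ) ≤ 2.7182818283 ^ 3 := by norm_num
      _ ≤ _ := by gcongr
  have key : ∀ i : ℕ, 3 * (64 * m * 16 ^ i) ≤ Real.exp (7 * L * (1 + i)) := by
    intro i
    have hi : (0 : ℝ) ≤ i := by positivity
    calc 3 * (64 * m * 16 ^ i) ≤ 3 * (64 * (2 * Real.exp L) * Real.exp 3 ^ i) := by gcongr
      _ = 384 * Real.exp L * Real.exp 3 ^ i := by ring
      _ ≤ Real.exp 6 * Real.exp L * Real.exp 3 ^ i := by gcongr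
      _ = Real.exp (6 + L + i * 3) := by rw [Real.exp_add, Real.exp_add, Real.exp_nat_mul]
      _ ≤ _ := by apply Real.exp_le_exp.2; nlinarith
  have k1 : (3 * (64 * m * 16 ^ j)) ^ p ≤ Real.exp (7 * (p * L) * (1 + j)) := by
    calc _ ≤ Real.exp (7 * L * (1 + j)) ^ p := by gcongr; exact key j
      _ = _ := by rw [← Real.exp_nat_mul]; congr 1; ring
  have k2 : (3 * (64 * m * 16 ^ (j + 1))) ^ p ≤ Real.exp (14 * (p * L) * (1 + j)) := by
    calc _ ≤ Real.exp (7 * L * (1 + (j + 1 : ℕ))) ^ p := by gcongr; exact key (j + 1)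
      _ = Real.exp (7 * (p * L) * (2 + j)) := by
        rw [← Real.exp_nat_mul]; congr 1; push_cast; ring
      _ ≤ _ := by
        apply Real.exp_le_exp.2
        have : 0 ≤ p * L := by positivity
        nlinarith [mul_nonneg this hj]
  set q := p * L with hq
  have hq1 : 1 ≤ q := by nlinarith
  have k3 : (3 * (64 * m * 16 ^ j)) ^ p +
      (3 * (64 * m * 16 ^ j)) ^ p * (3 * (64 * m * 16 ^ (j + 1))) ^ p ≤
      2 * Real.exp (21 * q * (1 + j)) := by
    have a : Real.exp (7 * q * (1 + j)) ≤ Real.exp (21 * q * (1 + j)) := by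
      apply Real.exp_le_exp.2; gcongr; norm_num
    have b : Real.exp (7 * q * (1 + j)) * Real.exp (14 * q * (1 + j)) =
        Real.exp (21 * q * (1 + j)) := by rw [← Real.exp_add]; congr 1; ring
    have c := mul_le_mul k1 k2 (by positivity) (by positivity)
    linarith
  have k4 : (2 : ℝ) ≤ Real.exp 1 := by linarith
  have k5 : 2 * Real.exp (21 * q * (1 + j)) ≤ (1 / 2) ^ (j + 1) * Real.exp (23 * q * (1 + j)) := by
    have : 2 * 2 ^ (j + 1) ≤ Real.exp (2 * q * (1 + j)) := by
      calc (2 : ℝ) * 2 ^ (j + 1) = 2 ^ (j + 2) := by ring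
        _ ≤ Real.exp 1 ^ (j + 2) := by gcongr
        _ = Real.exp ((j + 2 : ℕ) * 1) := by rw [Real.exp_nat_mul]
        _ ≤ _ := by apply Real.exp_le_exp.2; push_cast; nlinarith
    have h23 : Real.exp (23 * q * (1 + j)) = Real.exp (21 * q * (1 + j)) * Real.exp (2 * q * (1 + j)) := by
      rw [← Real.exp_add]; congr 1; ring
    rw [h23]
    have h1 : (1 / 2 : ℝ) ^ (j + 1) * 2 ^ (j + 1) = 1 := by rw [← mul_pow]; norm_num
    calc 2 * Real.exp (21 * q * (1 + j))
        = ((1 / 2 : ℝ) ^ (j + 1) * 2 ^ (j + 1)) * (2 * Real.exp (21 * q * (1 + j))) := by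
          rw [h1, one_mul]
      _ = (1 / 2 : ℝ) ^ (j + 1) * (Real.exp (21 * q * (1 + j)) * (2 * 2 ^ (j + 1))) := by ring
      _ ≤ _ := by gcongr
  have k6 : -(Real.sqrt (1 + j) * (8 * Real.sqrt q + 4 / 15 * u)) ^ 2 / 2 ≤
      -(23 * q * (1 + j)) + -u ^ 2 / (4 * Real.exp 1 ^ 2) := by
    rw [mul_pow, Real.sq_sqrt (by positivity)]
    have hs := Real.sq_sqrt (by positivity : 0 ≤ q)
    have hs0 := Real.sqrt_nonneg q
    have a : u ^ 2 / (4 * Real.exp 1 ^ 2) ≤ 8 / 225 * u ^ 2 := by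
      rw [div_le_iff₀ (by positivity)]
      have : (7.1 : ℝ) ≤ Real.exp 1 ^ 2 := by nlinarith
      nlinarith [sq_nonneg u]
    have b : 64 * q + 16 / 225 * u ^ 2 ≤ (8 * Real.sqrt q + 4 / 15 * u) ^ 2 := by
      nlinarith [mul_nonneg hs0 hu.le]
    have c := mul_le_mul_of_nonneg_left b (by positivity : (0 : ℝ) ≤ 1 + j)
    have d : 0 ≤ j * u ^ 2 := by positivity
    have e : 0 ≤ q * (1 + j) := by positivity
    rw [neg_div (4 * Real.exp 1 ^ 2)]
    nlinarith
  calc _ ≤ (1 / 2) ^ (j + 1) * Real.exp (23 * q * (1 + j)) *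
        Real.exp (-(23 * q * (1 + j)) + -u ^ 2 / (4 * Real.exp 1 ^ 2)) := by
        gcongr
        exact k3.trans k5
    _ = _ := by
        rw [mul_assoc, ← Real.exp_add]; congr 2; ring
lemma aux_core {p : ℕ} (hp : 0 < p) {Ω : Set (EuclideanSpace ℝ (Fin p))} (hne : Ω.Nonempty)
    {D A L : ℝ} (hD : 0 < D) (hΩ : ∀ x ∈ Ω, ∀ y ∈ Ω, ∀ i, |x i - y i| ≤ D)
    (hB : 1 ≤ A * D) (hL : 1 ≤ L) (hBL : A * D ≤ Real.exp L)
    {Ω' : Type*} [MeasurableSpace Ω'] (P : Measure Ω')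
    (W : EuclideanSpace ℝ (Fin p) → Ω' → ℝ) (s : EuclideanSpace ℝ (Fin p) → ℝ)
    (hs0 : ∀ x, 0 ≤ s x) (hs1 : ∀ x, s x ≤ 1)
    (T1 : ∀ x, ∀ t : ℝ, 0 ≤ t →
      P {ω | s x * t < W x ω} ≤ ENNReal.ofReal (Real.exp (-t ^ 2 / 2)))
    (T2 : ∀ x y, ∀ δ : ℝ, 0 ≤ δ → (∀ i, |x i - y i| ≤ δ) → ∀ t : ℝ, 0 ≤ t →
      P {ω | Real.sqrt (2 * A * δ) * t < W x ω - W y ω} ≤ ENNReal.ofReal (Real.exp (-t ^ 2 / 2)))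
    (T3 : ∀ x y, ∀ δ : ℝ, 0 ≤ δ → (∀ i, |x i - y i| ≤ δ) → s y ^ 2 ≤ 2 * s x ^ 2 + 4 * A * δ)
    (hcont : ∀ᵐ ω ∂P, ContinuousOn (fun x => W x ω) Ω) (u : ℝ) (hu : 0 < u) :
    P {ω | ∃ x ∈ Ω, 30 * Real.sqrt (p * L) + u <
        W x ω / (s x * Real.sqrt (Real.log (Real.exp 1 / s x)))} ≤
      ENNReal.ofReal (Real.exp (-u ^ 2 / (4 * Real.exp 1 ^ 2))) := by
  classical
  have hA : 0 < A := by
    by_contra! h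
    nlinarith
  set m : ℕ := ⌈A * D⌉₊ with hm
  have hm1 : A * D ≤ m := Nat.le_ceil _
  have hm2 : (m : ℝ) ≤ 2 * Real.exp L := by
    have := Nat.ceil_lt_add_one (by linarith : 0 ≤ A * D)
    linarith
  have hmpos : 0 < m := by
    have : (0 : ℝ) < m := by linarith
    exact_mod_cast this
  have hgrid := fun j : ℕ => aux_grid hne hD hΩ (64 * m * 16 ^ j) (by positivity)
  choose π hπΩ hπd T hπT hTc using hgrid
  set β := 8 * Real.sqrt (p * L) + 4 / 15 * u with hβ
  have hβ0 : 0 ≤ β := by positivity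
  have hMpos : ∀ j : ℕ, (0 : ℝ) < (64 * m * 16 ^ j : ℕ) := fun j => by
    have : 0 < 64 * m * 16 ^ j := by positivity
    exact_mod_cast this
  have hAD : ∀ j : ℕ, A * (D / (64 * m * 16 ^ j : ℕ)) ≤ ((1 / 4 : ℝ) ^ (j + 1)) ^ 2 / 4 := by
    intro j
    rw [← mul_div_assoc, div_le_iff₀ (hMpos j)]
    have : ((1 / 4 : ℝ) ^ (j + 1)) ^ 2 * 16 ^ (j + 1) = 1 := by
      rw [← pow_mul, mul_comm (j + 1) 2, pow_mul, ← mul_pow]; norm_num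
    push_cast
    calc A * D ≤ m * 1 := by simpa using hm1
      _ = m * (((1 / 4 : ℝ) ^ (j + 1)) ^ 2 * 16 ^ (j + 1)) := by rw [this]
      _ = _ := by ring
  let U : ℕ → Set Ω' := fun j =>
    (⋃ a ∈ T j, {ω | s a * (Real.sqrt (1 + j) * β) < W a ω}) ∪
    ⋃ ab ∈ (T j ×ˢ T (j + 1)).filter (fun ab => ∃ x ∈ Ω, ab = (π j x, π (j + 1) x)),
      {ω | (1 / 4 : ℝ) ^ (j + 1) * (Real.sqrt (1 + j) * β) < W ab.2 ω - W ab.1 ω}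
  have hU : ∀ j, P (U j) ≤
      ENNReal.ofReal ((1 / 2) ^ (j + 1) * Real.exp (-u ^ 2 / (4 * Real.exp 1 ^ 2))) := by
    intro j
    set E := ENNReal.ofReal (Real.exp (-(Real.sqrt (1 + j) * β) ^ 2 / 2)) with hE
    have hl0 : 0 ≤ Real.sqrt (1 + j) * β := by positivity
    have b1 : P (⋃ a ∈ T j, {ω | s a * (Real.sqrt (1 + j) * β) < W a ω}) ≤ (T j).card * E := by
      refine (measure_biUnion_finset_le _ _).trans ?_
      refine (Finset.sum_le_card_nsmul _ _ E fun a _ => T1 a _ hl0).trans ?_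
      rw [nsmul_eq_mul]
    have b2 : P (⋃ ab ∈ (T j ×ˢ T (j + 1)).filter (fun ab => ∃ x ∈ Ω, ab = (π j x, π (j + 1) x)),
      {ω | (1 / 4 : ℝ) ^ (j + 1) * (Real.sqrt (1 + j) * β) < W ab.2 ω - W ab.1 ω}) ≤
        ((T j).card * (T (j + 1)).card : ℕ) * E := by
      refine (measure_biUnion_finset_le _ _).trans ?_
      refine (Finset.sum_le_card_nsmul _ _ E ?_).trans ?_
      · intro ab hab
        obtain ⟨_, x, hx, rfl⟩ := Finset.mem_filter.1 hab
        simp only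
        set δ : ℝ := D / (64 * m * 16 ^ j : ℕ) + D / (64 * m * 16 ^ (j + 1) : ℕ) with hδ
        have hδ0 : 0 ≤ δ := by
          have := hMpos j; have := hMpos (j + 1); positivity
        have hd : ∀ i, |π (j + 1) x i - π j x i| ≤ δ := by
          intro i
          have c1 := hπd j x hx i
          have c2 := hπd (j + 1) x hx i
          have := abs_sub_le (π (j + 1) x i) (x i) (π j x i)
          rw [abs_sub_comm (π (j + 1) x i) (x i)] at this
          linarith
        refine (measure_mono ?_).trans (T2 _ _ δ hδ0 hd _ hl0)
        intro ω hω
        simp only [Set.mem_ofPred_eq] at hω ⊢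
        refine lt_of_le_of_lt ?_ hω
        gcongr
        rw [Real.sqrt_le_left (by positivity)]
        have c1 := hAD j
        have c2 := hAD (j + 1)
        have c3 : ((1 / 4 : ℝ) ^ (j + 1 + 1)) ^ 2 ≤ ((1 / 4 : ℝ) ^ (j + 1)) ^ 2 := by
          rw [pow_succ _ (j + 1), mul_pow]
          nlinarith [sq_nonneg ((1 / 4 : ℝ) ^ (j + 1))]
        rw [hδ]
        nlinarith
      · rw [nsmul_eq_mul]
        gcongr
        refine (Finset.card_filter_le _ _).trans ?_
        rw [Finset.card_product]
    refine (measure_union_le _ _).trans ((add_le_add b1 b2).trans ?_)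
    rw [← add_mul, ← Nat.cast_add, ← ENNReal.ofReal_natCast, hE, ← ENNReal.ofReal_mul (by positivity)]
    apply ENNReal.ofReal_le_ofReal
    refine le_trans ?_ (aux_num p hp L m u hL (by positivity) hm2 hu j)
    gcongr
    have c1 : ((T j).card : ℝ) ≤ (3 * (64 * m * 16 ^ j)) ^ p := by exact_mod_cast hTc j
    have c2 : ((T (j + 1)).card : ℝ) ≤ (3 * (64 * m * 16 ^ (j + 1))) ^ p := by
      exact_mod_cast hTc (j + 1)
    push_cast
    gcongr
  have hsub : ∀ᵐ ω ∂P, ω ∈ {ω | ∃ x ∈ Ω, 30 * Real.sqrt (p * L) + u <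
        W x ω / (s x * Real.sqrt (Real.log (Real.exp 1 / s x)))} → ω ∈ ⋃ j, U j := by
    filter_upwards [hcont] with ω hω
    rintro ⟨x, hx, hlt⟩
    by_contra hnot
    rw [Set.mem_iUnion] at hnot
    push Not at hnot
    have hbound : 30 * Real.sqrt (p * L) + u = 15 / 4 * β := by rw [hβ]; ring
    rw [hbound] at hlt
    refine absurd hlt (not_lt.2 ?_)
    rcases (hs0 x).eq_or_lt with h0 | hpos
    · rw [← h0]; simp; positivity
    have hd0 : ∀ j : ℕ, 0 ≤ D / (64 * m * 16 ^ j : ℕ) := fun j => by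
      have := hMpos j; positivity
    refine aux_chain (fun j => W (π j x) ω) (W x ω) (s x) β (fun j => s (π j x)) hβ0 hpos (hs1 x)
      ?_ ?_ ?_ ?_
    · have hπlim : Filter.Tendsto (fun j => π j x) Filter.atTop (nhds x) := by
        have hq : Filter.Tendsto (fun j : ℕ => D / (64 * m * 16 ^ j : ℕ)) Filter.atTop (nhds 0) := by
          apply Filter.Tendsto.const_div_atTop
          apply tendsto_natCast_atTop_atTop.comp
          apply Filter.Tendsto.const_mul_atTop' (by positivity)
          exact tendsto_pow_atTop_atTop_of_one_lt (by norm_num)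
        have : Filter.Tendsto (fun j => (WithLp.ofLp (π j x) : Fin p → ℝ)) Filter.atTop
            (nhds (WithLp.ofLp x)) := by
          rw [tendsto_pi_nhds]
          intro i
          rw [tendsto_iff_dist_tendsto_zero]
          refine squeeze_zero (fun _ => dist_nonneg) (fun j => ?_) hq
          rw [dist_comm, Real.dist_eq]
          exact hπd j x hx i
        exact ((PiLp.continuous_toLp 2 (fun _ : Fin p => ℝ)).tendsto _).comp this
      have h1 : Filter.Tendsto (fun j => π j x) Filter.atTop (nhdsWithin x Ω) :=
        tendsto_nhdsWithin_iff.2 ⟨hπlim, Filter.Eventually.of_forall fun j => hπΩ j x hx⟩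
      exact (hω x hx).tendsto.comp h1
    · intro j
      by_contra! hh
      refine hnot j (Or.inl ?_)
      simp only [Set.mem_iUnion]
      exact ⟨π j x, hπT j x hx, hh⟩
    · intro j
      by_contra! hh
      refine hnot j (Or.inr ?_)
      simp only [Set.mem_iUnion]
      refine ⟨(π j x, π (j + 1) x), ?_, hh⟩
      exact Finset.mem_filter.2 ⟨Finset.mk_mem_product (hπT j x hx) (hπT (j + 1) x hx), x, hx, rfl⟩
    · intro j
      have c1 := T3 x (π j x) _ (hd0 j) (hπd j x hx)
      have c2 := hAD j
      nlinarith
  refine (measure_mono_ae hsub).trans ((measure_iUnion_le _).trans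
    ((ENNReal.tsum_le_tsum hU).trans ?_))
  have hsum : HasSum (fun j : ℕ => (1 / 2 : ℝ) ^ (j + 1) * Real.exp (-u ^ 2 / (4 * Real.exp 1 ^ 2)))
      (Real.exp (-u ^ 2 / (4 * Real.exp 1 ^ 2))) := by
    have h := (hasSum_geometric_two.mul_left (1 / 2 : ℝ)).mul_right
      (Real.exp (-u ^ 2 / (4 * Real.exp 1 ^ 2)))
    simp only [← pow_succ'] at h
    rw [show (1 / 2 * 2 : ℝ) = 1 by norm_num, one_mul] at h
    exact h
  rw [← ENNReal.ofReal_tsum_of_nonneg (fun j => by positivity) hsum.summable, hsum.tsum_eq]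

/-- Peeling tail bound from the proof of Theorem 1 of the paper: there is a universal
constant η₂ such that for every u > 0,
`P(sup_{x∈Ω} (Z(x) − μ(x))/(σ(x) log^{1/2}(eσ/σ(x))) > η₂ √(p (1 ∨ log(A₀ D_Ω))) + u)
  ≤ exp(−u²/(4e²)) / (1 − exp(−u²/(4e²)))` (convention 0/0 = 0). -/
theorem stmt10 :
    ∃ η₂ : ℝ,
      ∀ (p : ℕ), 0 < p →
      ∀ (Ω : Set (EuclideanSpace ℝ (Fin p))), IsCompact Ω → Ω.Nonempty →
        0 < Metric.diam Ω →
      ∀ (Ψ Ψt : EuclideanSpace ℝ (Fin p) → ℝ), IsSpectralDensity Ψ Ψt →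
        Integrable (fun ω => (∑ i, |ω i|) * Ψt ω) →
      ∀ (σ : ℝ), 0 < σ →
      ∀ (Ω' : Type) [MeasurableSpace Ω'] (P : Measure Ω') [IsProbabilityMeasure P],
      ∀ (Z : EuclideanSpace ℝ (Fin p) → Ω' → ℝ),
        (∀ x, Measurable (Z x)) →
        (∀ᵐ ω' ∂P, ContinuousOn (fun x => Z x ω') Ω) →
        GaussCov P Z σ Ψ →
      ∀ (n : ℕ) (xs : Fin n → EuclideanSpace ℝ (Fin p)),
        (∀ i, xs i ∈ Ω) → IsUnit (kmat Ψ xs).det →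
      ∀ (u : ℝ), 0 < u →
        P {ω' | η₂ * Real.sqrt (p * max 1 (Real.log (A0 Ψt * Metric.diam Ω))) + u <
            ⨆ v : Ω, krigRatio Ψ xs σ (fun x => Z x ω') v} ≤
          ENNReal.ofReal (Real.exp (-u ^ 2 / (4 * Real.exp 1 ^ 2)) /
            (1 - Real.exp (-u ^ 2 / (4 * Real.exp 1 ^ 2)))) := by
  refine ⟨30, ?_⟩
  intro p hp Ω hΩc hne hDpos Ψ Ψt hΨ hA0 σ hσ Ω' _ P _ Z hZm hZc hG n xs hxs hdet u hu
  set D := Metric.diam Ω with hD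
  set A := max (A0 Ψt) (1 / D) with hA
  have hAA : A0 Ψt ≤ A := le_max_left _ _
  have hApos : 0 < A := lt_of_lt_of_le (by positivity) (le_max_right _ _)
  set L := max 1 (Real.log (A0 Ψt * D)) with hL
  have hB : 1 ≤ A * D := by
    have : 1 / D * D ≤ A * D := by gcongr; exact le_max_right _ _
    rwa [one_div_mul_cancel hDpos.ne'] at this
  have hL1 : 1 ≤ L := le_max_left _ _
  have hBL : A * D ≤ Real.exp L := by
    rw [hA, max_mul_of_nonneg _ _ hDpos.le, one_div_mul_cancel hDpos.ne']
    apply max_le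
    · rcases le_or_gt (A0 Ψt * D) 0 with h | h
      · exact h.trans (Real.exp_pos _).le
      · rw [← Real.log_le_iff_le_exp h]; exact le_max_right _ _
    · exact Real.one_le_exp (by linarith)
  have hΩd : ∀ x ∈ Ω, ∀ y ∈ Ω, ∀ i, |x i - y i| ≤ D := by
    intro x hx y hy i
    have h1 := Metric.dist_le_diam_of_mem hΩc.isBounded hx hy
    have h2 := PiLp.norm_apply_le (x - y) i
    rw [dist_eq_norm] at h1
    simp only [PiLp.sub_apply, Real.norm_eq_abs] at h2
    linarith
  -- the normalized residual
  set W : EuclideanSpace ℝ (Fin p) → Ω' → ℝ := fun x ω =>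
    (Z x ω - kinterp Ψ xs (fun x => Z x ω) x) / σ with hW
  have hWm : ∀ x, Measurable (W x) := by
    intro x
    simp only [hW, kinterp]
    fun_prop
  have hVnn : ∀ x y a b, 0 ≤ auxV Ψ xs x y a b := by
    intro x y a b
    obtain ⟨c, z, _, h2, _⟩ := aux_form hΨ xs hdet x y a b
    rw [← h2]; exact aux_quad_nonneg hΨ c z
  have hVle : ∀ x y δ, (∀ i, |x i - y i| ≤ δ) → auxV Ψ xs x y 1 (-1) ≤ 2 * A * δ := by
    intro x y δ hd
    obtain ⟨c, z, _, _, h3⟩ := aux_form hΨ xs hdet x y 1 (-1)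
    have h4 := aux_one_sub_psi hΨ hA0 (x - y) δ hd
    have hδ : 0 ≤ δ := (abs_nonneg _).trans (hd ⟨0, hp⟩)
    have := mul_le_mul_of_nonneg_right hAA hδ
    linarith
  have htail : ∀ x y a b V t, auxV Ψ xs x y a b ≤ V → 0 ≤ t →
      P {ω | Real.sqrt V * t < a * W x ω + b * W y ω} ≤
        ENNReal.ofReal (Real.exp (-t ^ 2 / 2)) := by
    intro x y a b V t hV ht
    obtain ⟨c, z, h1, h2, _⟩ := aux_form hΨ xs hdet x y a b
    have hlaw := aux_gauss_fintype hG (fun i => c i / σ) z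
    have e1 : (fun ω => ∑ i, c i / σ * Z (z i) ω) = fun ω => a * W x ω + b * W y ω := by
      funext ω
      have := h1 (fun x => Z x ω)
      simp only [hW]
      rw [mul_div_assoc', mul_div_assoc', ← add_div, ← this, Finset.sum_div]
      exact Finset.sum_congr rfl fun i _ => by ring
    have e2 : σ ^ 2 * ∑ i, ∑ j, c i / σ * (c j / σ) * Ψ (z i - z j) = auxV Ψ xs x y a b := by
      rw [← h2, Finset.mul_sum]
      refine Finset.sum_congr rfl fun i _ => ?_
      rw [Finset.mul_sum]
      refine Finset.sum_congr rfl fun j _ => ?_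
      field_simp
    rw [e1, e2] at hlaw
    refine aux_gtail P _ (by fun_prop) _ hlaw V t ((hVnn _ _ _ _).trans hV) ?_ ht
    rw [Real.coe_toNNReal _ (hVnn _ _ _ _)]
    exact hV
  set s : EuclideanSpace ℝ (Fin p) → ℝ := fun x => Real.sqrt (auxR Ψ xs x x) with hs
  have hR : ∀ x, auxV Ψ xs x x 1 0 = auxR Ψ xs x x := fun x => by simp [auxV]
  have hR0 : ∀ x, 0 ≤ auxR Ψ xs x x := fun x => hR x ▸ hVnn x x 1 0
  have hs1 : ∀ x, s x ≤ 1 := by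
    intro x
    obtain ⟨c, z, _, _, h3⟩ := aux_form hΨ xs hdet x x 1 0
    rw [hR] at h3
    rw [hs]
    exact Real.sqrt_le_one.2 (by linarith)
  have hΨc := aux_psi_cont hΨ
  have hcont : ∀ᵐ ω ∂P, ContinuousOn (fun x => W x ω) Ω := by
    filter_upwards [hZc] with ω hω
    refine (hω.sub (Continuous.continuousOn ?_)).div_const σ
    unfold kinterp
    fun_prop
  have hcore := aux_core hp hne hDpos hΩd hB hL1 hBL P W s (fun x => Real.sqrt_nonneg _) hs1
    (by
      intro x t ht
      simpa using htail x x 1 0 _ t (hR x).le ht)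
    (by
      intro x y δ _ hd t ht
      simpa [sub_eq_add_neg] using htail x y 1 (-1) _ t (hVle x y δ hd) ht)
    (by
      intro x y δ _ hd
      simp only [hs]
      rw [Real.sq_sqrt (hR0 _), Real.sq_sqrt (hR0 _)]
      have h1 := hVle x y δ hd
      have h2 := hVnn x y 2 (-1)
      simp only [auxV] at h1 h2
      linarith) hcont u hu
  have hratio : ∀ ω x, krigRatio Ψ xs σ (fun x => Z x ω) x =
      W x ω / (s x * Real.sqrt (Real.log (Real.exp 1 / s x))) := by
    intro ω x
    have e : krigSd Ψ xs σ x = σ * s x := by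
      simp only [krigSd, hs, auxR, sub_self, aux_psi_zero hΨ]
    rw [krigRatio, e]
    have e2 : Real.exp 1 * σ / (σ * s x) = Real.exp 1 / s x := by
      rw [mul_comm (Real.exp 1), mul_div_mul_left _ _ hσ.ne']
    rw [e2, mul_assoc, ← div_div]
  have : Nonempty Ω := hne.to_subtype
  refine (measure_mono ?_).trans (hcore.trans (ENNReal.ofReal_le_ofReal ?_))
  · intro ω hω
    simp only [Set.mem_ofPred_eq] at hω ⊢
    by_contra! hno
    refine absurd hω (not_lt.2 (ciSup_le fun v => ?_))
    rw [hratio]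
    exact hno v v.2
  · set q := Real.exp (-u ^ 2 / (4 * Real.exp 1 ^ 2)) with hq
    have hq0 : 0 < q := Real.exp_pos _
    have hq1 : q < 1 := by
      rw [hq, Real.exp_lt_one_iff, neg_div]
      have : 0 < u ^ 2 / (4 * Real.exp 1 ^ 2) := by positivity
      linarith
    rw [le_div_iff₀ (by linarith)]
    nlinarith
end

section
/- Let g(x) = Z(x) − μ(x) be the kriging residual process and, for a closed deterministic subset A ⊆ Ω, let σ_A = sup_{x∈A} σ(x). Then for all x, x' ∈ A, the natural metric 𝔡(x,x')² := E[(g(x) − g(x'))²] satisfies 𝔡(x,x')² ≤ 2√2 · A₀^{1/2} · σ · σ_A · ‖x − x'‖^{1/2}, where ‖·‖ is the Euclidean norm. -/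
open MeasureTheory ProbabilityTheory
open scoped RealInnerProductSpace

lemma aux_mem {p : ℕ} {Ω' : Type*} [MeasurableSpace Ω'] (P : Measure Ω') [IsProbabilityMeasure P]
    (f : Ω' → ℝ) (hf : Measurable f) (v : NNReal) (h : Measure.map f P = gaussianReal 0 v) :
    MemLp f 2 P ∧ ∫ ω, f ω ^ 2 ∂P = v := by
  have h1 : MemLp id 2 (Measure.map f P) := by
    rw [h]; exact memLp_id_gaussianReal 2
  constructor
  · have := (memLp_map_measure_iff h1.1 hf.aemeasurable).1 h1
    simpa using this
  · have h2 : ∫ y, y ^ 2 ∂(Measure.map f P) = ∫ ω, f ω ^ 2 ∂P :=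
      integral_map hf.aemeasurable (by fun_prop)
    rw [← h2, h]
    have h3 := variance_fun_id_gaussianReal (μ := 0) (v := v)
    rw [variance_eq_integral (by fun_prop)] at h3
    simpa using h3

lemma aux_spec {p : ℕ} (Ψ Ψt : EuclideanSpace ℝ (Fin p) → ℝ) (hspec : IsSpectralDensity Ψ Ψt)
    (hA0 : Integrable (fun ω => (∑ i, |ω i|) * Ψt ω)) :
    Ψ 0 = 1 ∧ (∀ v, |Ψ v| ≤ 1) ∧ (∀ v, Ψ (-v) = Ψ v) ∧ ∀ v, 1 - Ψ v ≤ A0 Ψt * ‖v‖ := by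
  obtain ⟨h0, hi, h1, hc⟩ := hspec
  have hint : ∀ v, Integrable (fun ω => Real.cos ⟪ω, v⟫ * Ψt ω) := by
    intro v
    refine hi.mono ((by fun_prop : Continuous fun ω : EuclideanSpace ℝ (Fin p) =>
      Real.cos ⟪ω, v⟫).aestronglyMeasurable.mul hi.1) (Filter.Eventually.of_forall fun ω => ?_)
    rw [norm_mul]
    exact mul_le_of_le_one_left (norm_nonneg _) (Real.abs_cos_le_one _)
  refine ⟨?_, ?_, ?_, ?_⟩
  · rw [hc]; simpa using h1
  · intro v
    rw [hc, ← h1]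
    refine (abs_integral_le_integral_abs).trans (integral_mono (hint v).abs hi fun ω => ?_)
    simp only [abs_mul, abs_of_nonneg (h0 ω)]
    exact mul_le_of_le_one_left (h0 ω) (Real.abs_cos_le_one _)
  · intro v
    rw [hc, hc]; simp [inner_neg_right]
  · intro v
    rw [hc, ← h1, ← integral_sub hi (hint v), A0, ← integral_mul_const]
    refine integral_mono (hi.sub (hint v)) (hA0.mul_const _) fun ω => ?_
    have hin : |⟪ω, v⟫| ≤ (∑ i, |ω i|) * ‖v‖ := by
      have : ⟪ω, v⟫ = ∑ i, ω i * v i := by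
        simp [PiLp.inner_apply, mul_comm]
      rw [this, Finset.sum_mul]
      refine (Finset.abs_sum_le_sum_abs _ _).trans (Finset.sum_le_sum fun i _ => ?_)
      rw [abs_mul]
      exact mul_le_mul_of_nonneg_left (PiLp.norm_apply_le v i) (abs_nonneg _)
    have hcos : 1 - Real.cos ⟪ω, v⟫ ≤ |⟪ω, v⟫| := by
      have a := Real.one_sub_sq_div_two_le_cos (x := ⟪ω, v⟫)
      have b := Real.neg_one_le_cos ⟪ω, v⟫
      rcases le_total (|⟪ω, v⟫|) 2 with h | h
      · have := sq_abs ⟪ω, v⟫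
        nlinarith [abs_nonneg ⟪ω, v⟫]
      · linarith
    have := mul_le_mul_of_nonneg_right (hcos.trans hin) (h0 ω)
    simp only [Pi.sub_apply]
    nlinarith [this]

/-- Hilbert space version of the residual. -/
noncomputable def aux_g {p n : ℕ} {H : Type*} [NormedAddCommGroup H] [InnerProductSpace ℝ H]
    (Ψ : EuclideanSpace ℝ (Fin p) → ℝ) (xs : Fin n → EuclideanSpace ℝ (Fin p))
    (z : EuclideanSpace ℝ (Fin p) → H) (v : EuclideanSpace ℝ (Fin p)) : H :=
  z v - ∑ j, ∑ k, (Ψ (v - xs j) * (kmat Ψ xs)⁻¹ j k) • z (xs k)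

lemma aux_H {p n : ℕ} {H : Type*} [NormedAddCommGroup H] [InnerProductSpace ℝ H]
    (Ψ : EuclideanSpace ℝ (Fin p) → ℝ) (xs : Fin n → EuclideanSpace ℝ (Fin p))
    (hK : IsUnit (kmat Ψ xs).det) (z : EuclideanSpace ℝ (Fin p) → H) (σ : ℝ) (hσ : 0 < σ)
    (hz : ∀ x y, ⟪z x, z y⟫ = σ ^ 2 * Ψ (x - y)) (h0 : Ψ 0 = 1) :
    (∀ v, ‖aux_g Ψ xs z v‖ = krigSd Ψ xs σ v) ∧ (∀ v, krigSd Ψ xs σ v ≤ σ) ∧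
    ∀ x y, ‖aux_g Ψ xs z x - aux_g Ψ xs z y‖ ≤ ‖z x - z y‖ ∧
      ‖aux_g Ψ xs z x - aux_g Ψ xs z y‖ ^ 2 ≤
      ‖z x - z y‖ * ‖aux_g Ψ xs z x - aux_g Ψ xs z y‖ := by
  have orth : ∀ v l, ⟪aux_g Ψ xs z v, z (xs l)⟫ = 0 := by
    intro v l
    have e : ∀ j, ∑ k, (kmat Ψ xs)⁻¹ j k * Ψ (xs k - xs l) = (1 : Matrix (Fin n) (Fin n) ℝ) j l := by
      intro j
      rw [← Matrix.nonsing_inv_mul _ hK, Matrix.mul_apply]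
      rfl
    simp only [aux_g, inner_sub_left, sum_inner, inner_smul_left, hz, RCLike.conj_to_real]
    have : ∀ j, ∑ k, Ψ (v - xs j) * (kmat Ψ xs)⁻¹ j k * (σ ^ 2 * Ψ (xs k - xs l))
        = σ ^ 2 * Ψ (v - xs j) * (1 : Matrix (Fin n) (Fin n) ℝ) j l := by
      intro j
      rw [← e, Finset.mul_sum]
      exact Finset.sum_congr rfl fun k _ => by ring
    simp only [this, Matrix.one_apply]
    simp
  have orth2 : ∀ v w, ⟪aux_g Ψ xs z v, aux_g Ψ xs z w⟫ = ⟪aux_g Ψ xs z v, z w⟫ := by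
    intro v w
    conv_lhs => rw [aux_g.eq_def Ψ xs z w]
    simp [inner_sub_right, inner_sum, inner_smul_right, orth]
  have hsymm : ∀ x y, Ψ (x - y) = Ψ (y - x) := by
    intro x y
    have h := real_inner_comm (z x) (z y)
    rw [hz, hz] at h
    exact (mul_left_cancel₀ (by positivity) h).symm
  have hsq : ∀ v, ‖aux_g Ψ xs z v‖ ^ 2 =
      σ ^ 2 * (1 - ∑ j, ∑ k, Ψ (v - xs j) * (kmat Ψ xs)⁻¹ j k * Ψ (v - xs k)) := by
    intro v
    rw [← real_inner_self_eq_norm_sq, orth2]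
    simp only [aux_g, inner_sub_left, sum_inner, inner_smul_left, hz, RCLike.conj_to_real, sub_self,
      h0, mul_sub, Finset.mul_sum]
    congr 1
    refine Finset.sum_congr rfl fun j _ => Finset.sum_congr rfl fun k _ => ?_
    rw [hsymm (xs k) v]; ring
  have key : ∀ x y, ‖aux_g Ψ xs z x - aux_g Ψ xs z y‖ ^ 2 ≤
      ‖z x - z y‖ * ‖aux_g Ψ xs z x - aux_g Ψ xs z y‖ := by
    intro x y
    rw [← real_inner_self_eq_norm_sq, mul_comm]
    have : ⟪aux_g Ψ xs z x - aux_g Ψ xs z y, aux_g Ψ xs z x - aux_g Ψ xs z y⟫ =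
        ⟪aux_g Ψ xs z x - aux_g Ψ xs z y, z x - z y⟫ := by
      simp only [inner_sub_left, inner_sub_right, orth2]
    rw [this]
    exact real_inner_le_norm _ _
  have hn : ∀ v, ‖aux_g Ψ xs z v‖ = krigSd Ψ xs σ v := by
    intro v
    rw [krigSd, ← Real.sqrt_sq (norm_nonneg (aux_g Ψ xs z v)), hsq,
      Real.sqrt_mul (sq_nonneg σ), Real.sqrt_sq hσ.le]
  refine ⟨hn, ?_, fun x y => ⟨?_, key x y⟩⟩
  · intro v
    rw [← hn]
    have a : ‖z v‖ ^ 2 = σ ^ 2 := by rw [← real_inner_self_eq_norm_sq, hz]; simp [h0]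
    have b : ‖z v‖ = σ := (sq_eq_sq₀ (norm_nonneg _) hσ.le).1 a
    have c : ‖aux_g Ψ xs z v‖ ^ 2 ≤ ‖aux_g Ψ xs z v‖ * ‖z v‖ := by
      rw [← real_inner_self_eq_norm_sq, orth2]
      exact real_inner_le_norm _ _
    rw [b] at c
    by_contra! h
    nlinarith
  · by_contra! h
    nlinarith [key x y, norm_nonneg (z x - z y)]

/-- Inequality (eq:dist) in the proof of Theorem 3 of the paper: for the kriging residual
process `g(x) = Z(x) − μ(x)`, a closed deterministic `A ⊆ Ω` and `σ_A = sup_{x∈A} σ(x)`,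
the natural metric satisfies, for all `x, x' ∈ A`,
`𝔡(x,x')² = E[(g(x) − g(x'))²] ≤ 2√2 A₀^{1/2} σ σ_A ‖x − x'‖^{1/2}`. -/
theorem stmt14 (p : ℕ) (hp : 0 < p)
    (Ω : Set (EuclideanSpace ℝ (Fin p))) (hΩc : IsCompact Ω) (hΩne : Ω.Nonempty)
    (Ψ Ψt : EuclideanSpace ℝ (Fin p) → ℝ) (hspec : IsSpectralDensity Ψ Ψt)
    (hA0 : Integrable (fun ω => (∑ i, |ω i|) * Ψt ω))
    (σ : ℝ) (hσ : 0 < σ)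
    (Ω' : Type) [MeasurableSpace Ω'] (P : Measure Ω') [IsProbabilityMeasure P]
    (Z : EuclideanSpace ℝ (Fin p) → Ω' → ℝ) (hZmeas : ∀ x, Measurable (Z x))
    (hgauss : GaussCov P Z σ Ψ)
    (n : ℕ) (xs : Fin n → EuclideanSpace ℝ (Fin p)) (hxs : ∀ i, xs i ∈ Ω)
    (hK : IsUnit (kmat Ψ xs).det)
    (A : Set (EuclideanSpace ℝ (Fin p))) (hAcl : IsClosed A) (hAΩ : A ⊆ Ω)
    (σA : ℝ) (hσA : σA = ⨆ v : A, krigSd Ψ xs σ v)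
    (x x' : EuclideanSpace ℝ (Fin p)) (hx : x ∈ A) (hx' : x' ∈ A) :
    (∫ ω', ((Z x ω' - kinterp Ψ xs (fun y => Z y ω') x) -
        (Z x' ω' - kinterp Ψ xs (fun y => Z y ω') x')) ^ 2 ∂P) ≤
      2 * Real.sqrt 2 * Real.sqrt (A0 Ψt) * σ * σA * Real.sqrt ‖x - x'‖ := by
  obtain ⟨hΨ0, hΨ1, hΨe, hΨl⟩ := aux_spec Ψ Ψt hspec hA0
  have hm : ∀ y, MemLp (Z y) 2 P ∧ ∫ ω, Z y ω ^ 2 ∂P = σ ^ 2 := by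
    intro y
    have h := hgauss 1 (fun _ => 1) (fun _ => y)
    simp only [Fin.sum_univ_one, one_mul, sub_self, hΨ0, mul_one] at h
    have := aux_mem (p := p) P _ (hZmeas y) _ h
    rwa [Real.coe_toNNReal _ (sq_nonneg σ)] at this
  have hcov : ∀ y w, ∫ ω, Z y ω * Z w ω ∂P = σ ^ 2 * Ψ (y - w) := by
    intro y w
    have h := hgauss 2 (fun _ => 1) ![y, w]
    simp only [Fin.sum_univ_two, one_mul, sub_self, hΨ0, mul_one, Matrix.cons_val_zero,
      Matrix.cons_val_one] at h
    have e : Ψ (w - y) = Ψ (y - w) := by rw [← hΨe, neg_sub]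
    have h2 := (aux_mem (p := p) P _ ((hZmeas y).add (hZmeas w)) _ h).2
    rw [e, Real.coe_toNNReal _ (by nlinarith [neg_le_of_abs_le (hΨ1 (y - w)), sq_nonneg σ])] at h2
    have i1 : Integrable (fun ω => Z y ω ^ 2) P := (hm y).1.integrable_sq
    have i2 : Integrable (fun ω => Z w ω ^ 2) P := (hm w).1.integrable_sq
    have i3 : Integrable (fun ω => Z y ω * Z w ω) P := (hm y).1.integrable_mul (hm w).1
    have e2 : ∫ ω, (Z y ω + Z w ω) ^ 2 ∂P =
        ∫ ω, (Z y ω ^ 2 + Z w ω ^ 2) + 2 * (Z y ω * Z w ω) ∂P := by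
      congr 1; ext ω; ring
    have i4 : Integrable (fun ω => Z y ω ^ 2 + Z w ω ^ 2) P := i1.add i2
    rw [integral_add i4 (i3.const_mul 2), integral_add i1 i2, integral_const_mul,
      (hm y).2, (hm w).2] at e2
    simp only [Pi.add_apply] at h2
    linarith
  let z : EuclideanSpace ℝ (Fin p) → Lp ℝ 2 P := fun y => (hm y).1.toLp (Z y)
  have hzc : ∀ y, (z y : Ω' → ℝ) =ᵐ[P] Z y := fun y => (hm y).1.coeFn_toLp
  have hz : ∀ y w, ⟪z y, z w⟫ = σ ^ 2 * Ψ (y - w) := by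
    intro y w
    rw [L2.inner_def, ← hcov]
    refine integral_congr_ae ?_
    filter_upwards [hzc y, hzc w] with ω h1 h2
    simp [h1, h2, mul_comm]
  obtain ⟨hn, hle, hk⟩ := aux_H Ψ xs hK z σ hσ hz hΨ0
  have hgc : ∀ v, ((aux_g Ψ xs z v : Lp ℝ 2 P) : Ω' → ℝ) =ᵐ[P]
      fun ω' => Z v ω' - kinterp Ψ xs (fun y => Z y ω') v := by
    intro v
    have c1 := Lp.coeFn_sub (z v)
      (∑ j, ∑ k, (Ψ (v - xs j) * (kmat Ψ xs)⁻¹ j k) • z (xs k))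
    have c2 := Lp.coeFn_finsetSum Finset.univ
      (fun j => ∑ k, (Ψ (v - xs j) * (kmat Ψ xs)⁻¹ j k) • z (xs k))
    have c3 := ae_all_iff.2 fun j => Lp.coeFn_finsetSum Finset.univ
      (fun k => (Ψ (v - xs j) * (kmat Ψ xs)⁻¹ j k) • z (xs k))
    have c4 := ae_all_iff.2 fun j => ae_all_iff.2 fun k =>
      Lp.coeFn_smul (Ψ (v - xs j) * (kmat Ψ xs)⁻¹ j k) (z (xs k))
    have c5 := ae_all_iff.2 fun k => hzc (xs k)
    filter_upwards [c1, c2, c3, c4, c5, hzc v] with ω h1 h2 h3 h4 h5 h6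
    rw [aux_g, h1, Pi.sub_apply, h2, h6, kinterp]
    simp only [Finset.sum_apply, h3, h4, Pi.smul_apply, smul_eq_mul, h5]
  have hd : (∫ ω', ((Z x ω' - kinterp Ψ xs (fun y => Z y ω') x) -
        (Z x' ω' - kinterp Ψ xs (fun y => Z y ω') x')) ^ 2 ∂P) =
      ‖aux_g Ψ xs z x - aux_g Ψ xs z x'‖ ^ 2 := by
    rw [← real_inner_self_eq_norm_sq, L2.inner_def]
    refine integral_congr_ae ?_
    filter_upwards [hgc x, hgc x', Lp.coeFn_sub (aux_g Ψ xs z x) (aux_g Ψ xs z x')] with ω h1 h2 h3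
    rw [h3]
    simp [h1, h2, pow_two]
  have hbd : BddAbove (Set.range fun v : A => krigSd Ψ xs σ v) := by
    refine ⟨σ, ?_⟩
    rintro _ ⟨v, rfl⟩
    exact hle v
  have hsup : ∀ v ∈ A, ‖aux_g Ψ xs z v‖ ≤ σA := by
    intro v hv
    rw [hn, hσA]
    exact le_ciSup hbd (⟨v, hv⟩ : A)
  have hdz : ‖z x - z x'‖ ≤ Real.sqrt 2 * Real.sqrt (A0 Ψt) * σ * Real.sqrt ‖x - x'‖ := by
    have h1 : ‖z x - z x'‖ ^ 2 ≤ 2 * A0 Ψt * σ ^ 2 * ‖x - x'‖ := by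
      rw [← real_inner_self_eq_norm_sq]
      simp only [inner_sub_left, inner_sub_right, hz, sub_self, hΨ0]
      have e : Ψ (x' - x) = Ψ (x - x') := by rw [← hΨe, neg_sub]
      rw [e]
      nlinarith [mul_le_mul_of_nonneg_left (hΨl (x - x')) (sq_nonneg σ)]
    have hA : 0 ≤ A0 Ψt := integral_nonneg fun ω =>
      mul_nonneg (Finset.sum_nonneg fun i _ => abs_nonneg _) (hspec.1 ω)
    refine le_of_sq_le_sq ?_ (by positivity)
    simp only [mul_pow, Real.sq_sqrt hA, Real.sq_sqrt (norm_nonneg (x - x')),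
      Real.sq_sqrt (zero_le_two : (0:ℝ) ≤ 2)]
    exact h1
  have hdg : ‖aux_g Ψ xs z x - aux_g Ψ xs z x'‖ ≤ 2 * σA :=
    (norm_sub_le _ _).trans (by linarith [hsup x hx, hsup x' hx'])
  rw [hd]
  calc _ ≤ _ := (hk x x').2
    _ ≤ (Real.sqrt 2 * Real.sqrt (A0 Ψt) * σ * Real.sqrt ‖x - x'‖) * (2 * σA) :=
        mul_le_mul hdz hdg (norm_nonneg _) (by positivity)
    _ = _ := by ring
end

section
/- Let p ≥ 1 be an integer, σ ≥ σ_A > 0 real numbers, and K > 0 (playing the role of A₀D_Ω). Then ∫₀^{σ_A} √( p · log( 48 K σ² σ_A² / ε⁴ + 1 ) ) dε ≤ √(6 log(7e)) · √( p · (1 ∨ log K) ) · σ_A · √( log(eσ/σ_A) ), where a ∨ b denotes max(a,b) and e is Euler's number. -/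
/-- Entropy-integral bound (eq:boundEC1) in the proof of Theorem 3 of the paper:
for an integer p ≥ 1, reals σ ≥ σ_A > 0 and K > 0 (playing the role of A₀·D_Ω),
`∫₀^{σ_A} √(p log(48 K σ² σ_A²/ε⁴ + 1)) dε
  ≤ √(6 log(7e)) √(p (1 ∨ log K)) σ_A √(log(eσ/σ_A))`. -/
theorem stmt16 (p : ℕ) (hp : 1 ≤ p) (σ σA K : ℝ)
    (hσA : 0 < σA) (hσ : σA ≤ σ) (hK : 0 < K) :
    (∫ ε in (0:ℝ)..σA,
        Real.sqrt (p * Real.log (48 * K * σ ^ 2 * σA ^ 2 / ε ^ 4 + 1))) ≤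
      Real.sqrt (6 * Real.log (7 * Real.exp 1)) *
        Real.sqrt (p * max 1 (Real.log K)) * σA *
        Real.sqrt (Real.log (Real.exp 1 * σ / σA)) := by
  have hσ0 : 0 < σ := lt_of_lt_of_le hσA hσ
  have hp' : (1:ℝ) ≤ p := by exact_mod_cast hp
  set L := max 1 (Real.log K) with hL
  have hL1 : 1 ≤ L := le_max_left _ _
  have hKL : Real.log K ≤ L := le_max_right _ _
  have hKe : K ≤ Real.exp L := (Real.log_le_iff_le_exp hK).1 hKL
  have h7 : Real.log (7 * Real.exp 1) = Real.log 7 + 1 := by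
    rw [Real.log_mul (by norm_num) (Real.exp_pos 1).ne', Real.log_exp]
  have hr : Real.log (Real.exp 1 * σ / σA) = 1 + (Real.log σ - Real.log σA) := by
    rw [Real.log_div (by positivity) hσA.ne', Real.log_mul (Real.exp_pos 1).ne' hσ0.ne',
      Real.log_exp]
    ring
  have hl7 : 0 ≤ Real.log 7 := Real.log_nonneg (by norm_num)
  have hR : 0 ≤ Real.log σ - Real.log σA := sub_nonneg.2 (Real.log_le_log hσA hσ)
  rw [h7, hr]
  set R := Real.log σ - Real.log σA with hRdef
  set M : ℝ := 6 * (Real.log 7 + 1) * (p * L) * (1 + R) with hM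
  have hMpos : 0 < M := by positivity
  have hrhs : Real.sqrt (6 * (Real.log 7 + 1)) * Real.sqrt (p * L) * σA * Real.sqrt (1 + R)
      = σA * Real.sqrt M := by
    rw [hM, Real.sqrt_mul (x := 6 * (Real.log 7 + 1) * (p * L)) (by positivity),
      Real.sqrt_mul (x := 6 * (Real.log 7 + 1)) (by positivity) (p * L)]
    ring
  rw [hrhs]
  set s := Real.sqrt M with hs
  have hspos : 0 < s := Real.sqrt_pos.2 hMpos
  have hss : s * s = M := Real.mul_self_sqrt hMpos.le
  set C : ℝ := 2 * Real.log 7 + L + 2 * R with hC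
  have hCM : p * (C + 4) ≤ M := by
    have h1 : C + 4 ≤ 6 * (Real.log 7 + 1) * L * (1 + R) := by
      have e1 : 0 ≤ Real.log 7 * (L - 1) := mul_nonneg hl7 (by linarith)
      have e2 : 0 ≤ R * (L - 1) := mul_nonneg hR (by linarith)
      have e3 : 0 ≤ Real.log 7 * L * R := by positivity
      rw [hC]
      nlinarith
    calc (p:ℝ) * (C + 4) ≤ p * (6 * (Real.log 7 + 1) * L * (1 + R)) := by gcongr
      _ = M := by rw [hM]; ring
  have hpt : ∀ ε ∈ Set.Ioc 0 σA,
      Real.sqrt (p * Real.log (48 * K * σ ^ 2 * σA ^ 2 / ε ^ 4 + 1)) ≤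
        (p * (C + 4 * Real.log σA) + M) / (2 * s) - (4 * p) / (2 * s) * Real.log ε := by
    rintro ε ⟨h0, h1⟩
    have hlog : Real.log (48 * K * σ ^ 2 * σA ^ 2 / ε ^ 4 + 1) ≤
        C + 4 * Real.log σA - 4 * Real.log ε := by
      have hle : 48 * K * σ ^ 2 * σA ^ 2 / ε ^ 4 + 1 ≤
          7 ^ 2 * Real.exp L * σ ^ 2 * σA ^ 2 / ε ^ 4 := by
        have hone : 1 ≤ Real.exp L := Real.one_le_exp (by linarith)
        have h4 : ε ^ 4 ≤ Real.exp L * (σ ^ 2 * σA ^ 2) := by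
          calc ε ^ 4 = 1 * (ε ^ 2 * ε ^ 2) := by ring
            _ ≤ Real.exp L * (σ ^ 2 * σA ^ 2) := by
              have := h1.trans hσ
              gcongr
        have hk : K * (σ ^ 2 * σA ^ 2) ≤ Real.exp L * (σ ^ 2 * σA ^ 2) := by gcongr
        rw [div_add_one (by positivity)]
        gcongr
        nlinarith
      refine (Real.log_le_log (by positivity) hle).trans (le_of_eq ?_)
      rw [Real.log_div (by positivity) (by positivity), Real.log_mul (by positivity) (by positivity),
        Real.log_mul (by positivity) (by positivity), Real.log_mul (by positivity) (by positivity),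
        Real.log_pow, Real.log_pow, Real.log_pow, Real.log_pow, Real.log_exp, hC, hRdef]
      push_cast
      ring
    set x := Real.log (48 * K * σ ^ 2 * σA ^ 2 / ε ^ 4 + 1) with hx
    have hx0 : 0 ≤ x := Real.log_nonneg (by
      have : 0 ≤ 48 * K * σ ^ 2 * σA ^ 2 / ε ^ 4 := by positivity
      linarith)
    have hq : Real.sqrt (p * x) * Real.sqrt (p * x) = p * x := Real.mul_self_sqrt (by positivity)
    have hpx : p * x ≤ p * (C + 4 * Real.log σA - 4 * Real.log ε) := by gcongr
    have : (p * (C + 4 * Real.log σA) + M) / (2 * s) - (4 * p) / (2 * s) * Real.log ε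
        = (p * (C + 4 * Real.log σA - 4 * Real.log ε) + M) / (2 * s) := by
      field_simp
      ring
    rw [this, le_div_iff₀ (by positivity)]
    nlinarith [sq_nonneg (Real.sqrt (p * x) - s)]
  have hint : IntervalIntegrable (fun ε => (p * (C + 4 * Real.log σA) + M) / (2 * s)
      - (4 * p) / (2 * s) * Real.log ε) MeasureTheory.volume 0 σA :=
    intervalIntegrable_const.sub (intervalIntegral.intervalIntegrable_log'.const_mul _)
  have hmono : (∫ ε in (0:ℝ)..σA,
        Real.sqrt (p * Real.log (48 * K * σ ^ 2 * σA ^ 2 / ε ^ 4 + 1))) ≤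
      ∫ ε in (0:ℝ)..σA, ((p * (C + 4 * Real.log σA) + M) / (2 * s)
        - (4 * p) / (2 * s) * Real.log ε) := by
    rw [intervalIntegral.integral_of_le hσA.le, intervalIntegral.integral_of_le hσA.le]
    refine MeasureTheory.integral_mono_of_nonneg
      (Filter.Eventually.of_forall fun _ => Real.sqrt_nonneg _) hint.1 ?_
    exact (MeasureTheory.ae_restrict_iff' measurableSet_Ioc).2 (Filter.Eventually.of_forall hpt)
  refine hmono.trans ?_
  rw [intervalIntegral.integral_sub intervalIntegrable_const
    (intervalIntegral.intervalIntegrable_log'.const_mul _), intervalIntegral.integral_const,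
    intervalIntegral.integral_const_mul, integral_log]
  have heq : (σA - 0) • ((p * (C + 4 * Real.log σA) + M) / (2 * s)) -
      4 * p / (2 * s) * (σA * Real.log σA - 0 * Real.log 0 - σA + 0)
      = σA * ((p * (C + 4) + M) / (2 * s)) := by
    rw [smul_eq_mul]
    field_simp
    ring
  rw [heq]
  gcongr
  rw [div_le_iff₀ (by positivity)]
  nlinarith
end
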